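/- arXiv:2202.03637 — 3 statements merged into one kernel-verified Lean document; each statement's English description precedes it below -/
import Mathlib

section
/- Let B_G be the Boolean game associated with a Kw game G. For all players i ∈ N, all strategy profiles s ∈ S, and all goals γ_i: s ⊨ γ_i in the epistemic semantics of G if and only if η(ṡ) ⊨ γ_i, where γ_i on the right is read as a Boolean formula over the atoms Kw_j p_i and satisfaction is classical propositional satisfaction at the valuation η(ṡ) ⊆ Q. -/
open Classical

/-! ## Basic setting: players, variables, strategies, observation relations -/

/-- A strategy for player `i`: it assigns to each player `j` the set of variables
(all observed/owned by `i`) that `i` reveals to `j`, where `i` "reveals" all of its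
own variables to itself. -/
structure Strategy {ι P : Type} (owner : P → ι) (i : ι) where
  reveal : ι → Set P
  reveal_subset : ∀ j, reveal j ⊆ {p | owner p = i}
  reveal_self : reveal i = {p | owner p = i}

/-- A strategy profile: one strategy per player. -/
abbrev Profile {ι P : Type} (owner : P → ι) : Type := ∀ i, Strategy owner i

/-- `P_i(s)`: the set of variables revealed to player `i` in profile `s`. -/
def revealedTo {ι P : Type} (owner : P → ι) (s : Profile owner) (i : ι) : Set P :=
  {p | ∃ j, p ∈ (s j).reveal i}

/-- The observation relation `v ∼_i^s w`. -/
def obsRel {ι P : Type} (owner : P → ι) (s : Profile owner) (i : ι) (v w : Set P) : Prop :=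
  v ∩ revealedTo owner s i = w ∩ revealedTo owner s i

/-- The initial observation relation `v ∼_i w`. -/
def obsInit {ι P : Type} (owner : P → ι) (i : ι) (v w : Set P) : Prop :=
  v ∩ {p | owner p = i} = w ∩ {p | owner p = i}

/-! ## The epistemic language `L^K` and its semantics -/

/-- The epistemic language `L^K`: atoms, negation, disjunction, knowledge. -/
inductive Form (ι P : Type) : Type where
  | atom : P → Form ι P
  | neg : Form ι P → Form ι P
  | or : Form ι P → Form ι P → Form ι P
  | know : ι → Form ι P → Form ι P

/-- Conjunction, defined by abbreviation. -/
def Form.and {ι P : Type} (α β : Form ι P) : Form ι P := .neg (.or (.neg α) (.neg β))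

/-- `K̂_i α := ¬ K_i ¬ α`. -/
def Form.hatK {ι P : Type} (i : ι) (α : Form ι P) : Form ι P := .neg (.know i (.neg α))

/-- `Kw_i α := K_i α ∨ K_i ¬ α`. -/
def Form.Kw {ι P : Type} (i : ι) (α : Form ι P) : Form ι P :=
  .or (.know i α) (.know i (.neg α))

/-- Satisfaction `v,s ⊨ α`. -/
def sat {ι P : Type} (owner : P → ι) : Set P → Profile owner → Form ι P → Prop
  | v, _, .atom p => p ∈ v
  | v, s, .neg α => ¬ sat owner v s α
  | v, s, .or α β => sat owner v s α ∨ sat owner v s β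
  | v, s, .know i α => ∀ w, obsRel owner s i v w → sat owner w s α

/-- The fragment `L^Kw` of knowing-whether formulas (as a subset of `L^K`). -/
inductive IsKw {ι P : Type} : Form ι P → Prop
  | kw (j : ι) (p : P) : IsKw (Form.Kw j (.atom p))
  | neg {α : Form ι P} : IsKw α → IsKw (.neg α)
  | or {α β : Form ι P} : IsKw α → IsKw β → IsKw (.or α β)

/-- The fragment `L^K_nnf` of formulas in negation normal form. -/
inductive IsNNF {ι P : Type} : Form ι P → Prop
  | atom (p : P) : IsNNF (.atom p)
  | natom (p : P) : IsNNF (.neg (.atom p))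
  | and {α β : Form ι P} : IsNNF α → IsNNF β → IsNNF (Form.and α β)
  | or {α β : Form ι P} : IsNNF α → IsNNF β → IsNNF (.or α β)
  | know {α : Form ι P} (i : ι) : IsNNF α → IsNNF (.know i α)
  | hatK {α : Form ι P} (i : ι) : IsNNF α → IsNNF (Form.hatK i α)

/-- The fragment `L^Kw_nnf`. -/
inductive IsKwNNF {ι P : Type} : Form ι P → Prop
  | kw (j : ι) (p : P) : IsKwNNF (Form.Kw j (.atom p))
  | nkw (j : ι) (p : P) : IsKwNNF (.neg (Form.Kw j (.atom p)))
  | or {α β : Form ι P} : IsKwNNF α → IsKwNNF β → IsKwNNF (.or α β)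
  | and {α β : Form ι P} : IsKwNNF α → IsKwNNF β → IsKwNNF (Form.and α β)

/-! ## Uniform strategies, expected outcomes, Nash equilibria -/

/-- A uniform strategy profile assigns to each player a map from valuations to strategies. -/
abbrev UProfile {ι P : Type} (owner : P → ι) : Type := ∀ i, Set P → Strategy owner i

/-- Uniformity: the same strategy on indistinguishable valuations. -/
def IsUniform {ι P : Type} (owner : P → ι) (i : ι) (f : Set P → Strategy owner i) : Prop :=
  ∀ v w, obsInit owner i v w → f v = f w

/-- Global uniformity: the same strategy on all valuations. -/
def IsGUniform {ι P : Type} (owner : P → ι) (i : ι) (f : Set P → Strategy owner i) : Prop :=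
  ∀ v w, f v = f w

/-- The strategy profile `us(v)` determined by a uniform strategy profile at valuation `v`. -/
def applyU {ι P : Type} (owner : P → ι) (us : UProfile owner) (v : Set P) : Profile owner :=
  fun i => us i v

/-- The outcome `u_i(v,s)`: `1` if player `i`'s goal (described by `win`) holds, else `0`. -/
noncomputable def outcome {ι P : Type} (owner : P → ι)
    (win : ι → Set P → Profile owner → Prop) (i : ι) (v : Set P) (s : Profile owner) : ℕ :=
  if win i v s then 1 else 0

/-- Nash equilibrium of the pointed game `G(v)`. -/
def pointedNE {ι P : Type} [DecidableEq ι] (owner : P → ι)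
    (win : ι → Set P → Profile owner → Prop) (v : Set P) (s : Profile owner) : Prop :=
  ∀ (i : ι) (s' : Strategy owner i),
    outcome owner win i v s ≥ outcome owner win i v (Function.update s i s')

/-- `min 𝐮_i(v,us)`: the minimum of the expected outcome of player `i` over its
information set (a vector of `0`s and `1`s). -/
noncomputable def pessVal {ι P : Type} (owner : P → ι)
    (win : ι → Set P → Profile owner → Prop) (i : ι) (v : Set P) (us : UProfile owner) : ℕ :=
  if ∀ w, obsInit owner i v w → outcome owner win i w (applyU owner us w) = 1 then 1 else 0

/-- `max 𝐮_i(v,us)`: the maximum of the expected outcome of player `i` over its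
information set. -/
noncomputable def optVal {ι P : Type} (owner : P → ι)
    (win : ι → Set P → Profile owner → Prop) (i : ι) (v : Set P) (us : UProfile owner) : ℕ :=
  if ∃ w, obsInit owner i v w ∧ outcome owner win i w (applyU owner us w) = 1 then 1 else 0

/-- The maximal outcome relation `𝐮_i(v,us) >^max 𝐮_i(v,us')`. -/
def maxGt {ι P : Type} (owner : P → ι) (win : ι → Set P → Profile owner → Prop)
    (i : ι) (v : Set P) (us us' : UProfile owner) : Prop :=
  ∃ w, obsInit owner i v w ∧
    outcome owner win i w (applyU owner us w) > outcome owner win i w (applyU owner us' w)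

/-- Maximal Nash equilibrium: a uniform strategy profile from which no player has a
profitable deviation w.r.t. the maximal outcome relation. -/
def NEmax {ι P : Type} [DecidableEq ι] (owner : P → ι)
    (win : ι → Set P → Profile owner → Prop) (us : UProfile owner) : Prop :=
  (∀ i, IsUniform owner i (us i)) ∧
  ∀ (i : ι) (f : Set P → Strategy owner i), IsUniform owner i f →
    ∀ v, ¬ maxGt owner win i v (Function.update us i f) us

/-- Pessimist Nash equilibrium. -/
def NEpess {ι P : Type} [DecidableEq ι] (owner : P → ι)
    (win : ι → Set P → Profile owner → Prop) (us : UProfile owner) : Prop :=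
  (∀ i, IsUniform owner i (us i)) ∧
  ∀ (i : ι) (f : Set P → Strategy owner i), IsUniform owner i f →
    ∀ v, ¬ (pessVal owner win i v (Function.update us i f) > pessVal owner win i v us)

/-- Optimist Nash equilibrium. -/
def NEopt {ι P : Type} [DecidableEq ι] (owner : P → ι)
    (win : ι → Set P → Profile owner → Prop) (us : UProfile owner) : Prop :=
  (∀ i, IsUniform owner i (us i)) ∧
  ∀ (i : ι) (f : Set P → Strategy owner i), IsUniform owner i f →
    ∀ v, ¬ (optVal owner win i v (Function.update us i f) > optVal owner win i v us)

/-! ## Boolean formulas and knowing-whether formulas -/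

/-- Boolean formulas `L^B` over a set of variables. -/
inductive BForm (P : Type) : Type where
  | atom : P → BForm P
  | neg : BForm P → BForm P
  | or : BForm P → BForm P → BForm P

/-- Classical propositional satisfaction of Boolean formulas. -/
def bsat {P : Type} (v : Set P) : BForm P → Prop
  | .atom p => p ∈ v
  | .neg α => ¬ bsat v α
  | .or α β => bsat v α ∨ bsat v β

/-- The language `L^Kw` of knowing-whether formulas (as a language of its own). -/
inductive KwForm (ι P : Type) : Type where
  | kw : ι → P → KwForm ι P
  | neg : KwForm ι P → KwForm ι P
  | or : KwForm ι P → KwForm ι P → KwForm ι P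

/-- `Kw_j p` holds at `(v,s)`: player `j` knows whether `p`. -/
def kwHolds {ι P : Type} (owner : P → ι) (v : Set P) (s : Profile owner)
    (j : ι) (p : P) : Prop :=
  (∀ w, obsRel owner s j v w → p ∈ w) ∨ (∀ w, obsRel owner s j v w → p ∉ w)

/-- Epistemic satisfaction of knowing-whether formulas. -/
def ksat {ι P : Type} (owner : P → ι) : Set P → Profile owner → KwForm ι P → Prop
  | v, s, .kw j p => kwHolds owner v s j p
  | v, s, .neg α => ¬ ksat owner v s α
  | v, s, .or α β => ksat owner v s α ∨ ksat owner v s β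

/-! ## From Boolean games to Kw games -/

/-- The translation `λ : L^B → L^Kw`, mapping `p_i` to `Kw_{i⁺} p_i` where `i⁺` is the
(cyclic) successor of `i`. -/
def lam {P : Type} {n : ℕ} [NeZero n] (owner : P → Fin n) : BForm P → KwForm (Fin n) P
  | .atom p => .kw (owner p + 1) p
  | .neg α => .neg (lam owner α)
  | .or α β => .or (lam owner α) (lam owner β)

/-- The strategy profile `s^w` associated with a valuation `w`: each player `i` reveals
(to its cyclic successor `i⁺`, and no one else) exactly its variables that are in `w`. -/
def profOf {P : Type} {n : ℕ} [NeZero n] (owner : P → Fin n) (w : Set P) :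
    Profile owner := fun i =>
  { reveal := fun j =>
      if j = i then {p | owner p = i}
      else if j = i + 1 then {p | owner p = i ∧ p ∈ w}
      else ∅
    reveal_subset := by
      intro j
      by_cases h1 : j = i
      · rw [if_pos h1]
      · rw [if_neg h1]
        by_cases h2 : j = i + 1
        · rw [if_pos h2]; exact fun p hp => hp.1
        · rw [if_neg h2]; exact fun p hp => absurd hp (Set.notMem_empty p)
    reveal_self := by rw [if_pos rfl] }

/-- Outcome function of a Boolean game. -/
noncomputable def bOutcome {ι P : Type} (owner : P → ι) (γ : ι → BForm P)
    (i : ι) (v : Set P) : ℕ :=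
  if bsat v (γ i) then 1 else 0

/-- The valuation `(v'_i, v_{-i})` resulting from player `i` deviating, in a Boolean
game, to the local valuation `vi` (only the part of `vi` inside `P_i` matters). -/
def bDeviate {ι P : Type} (owner : P → ι) (v : Set P) (i : ι) (vi : Set P) : Set P :=
  {p | if owner p = i then p ∈ vi else p ∈ v}

/-- Nash equilibrium of a Boolean game. -/
def BNE {ι P : Type} (owner : P → ι) (γ : ι → BForm P) (v : Set P) : Prop :=
  ∀ (i : ι) (vi : Set P), bOutcome owner γ i v ≥ bOutcome owner γ i (bDeviate owner v i vi)

/-! ## Globally uniform strategy profiles, the equivalence `≡`, and `χ` -/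

/-- The set `𝐒^g` of globally uniform strategy profiles. -/
def GProfile {ι P : Type} (owner : P → ι) : Type :=
  {us : UProfile owner // ∀ i, IsGUniform owner i (us i)}

/-- The equivalence `ṡ ≡ ṫ iff s_i(i⁺) = t_i(i⁺) for all i` on globally uniform
strategy profiles. -/
def gSetoid {P : Type} {n : ℕ} [NeZero n] (owner : P → Fin n) :
    Setoid (GProfile owner) where
  r us ut := ∀ i, (us.1 i ∅).reveal (i + 1) = (ut.1 i ∅).reveal (i + 1)
  iseqv := ⟨fun _ _ => rfl, fun h i => (h i).symm, fun h h' i => (h i).trans (h' i)⟩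

/-- The map `χ : V → 𝐒^g/≡`, `χ(v) = [ṡ^v]`. -/
def chi {P : Type} {n : ℕ} [NeZero n] (owner : P → Fin n) (w : Set P) :
    Quotient (gSetoid owner) :=
  Quotient.mk (gSetoid owner) ⟨fun i _ => profOf owner w i, fun _ _ _ => rfl⟩

/-! ## From Kw games to Boolean games -/

/-- The set `Q` of variables of the Boolean game associated with a Kw game:
pairs `(j,p)` standing for the atom `Kw_j p` with `j ≠ owner p`. -/
def QVar {ι P : Type} (owner : P → ι) : Type := {q : ι × P // q.1 ≠ owner q.2}

/-- Classical propositional satisfaction of knowing-whether formulas read as Boolean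
formulas over the atoms `Q`. -/
def kbsat {ι P : Type} (owner : P → ι) (w : Set (QVar owner)) : KwForm ι P → Prop
  | .kw j p => ∃ h : j ≠ owner p, (⟨(j, p), h⟩ : QVar owner) ∈ w
  | .neg α => ¬ kbsat owner w α
  | .or α β => kbsat owner w α ∨ kbsat owner w β

/-- A knowing-whether formula contains no trivial constituent `Kw_i p_i`. -/
inductive NoTrivial {ι P : Type} (owner : P → ι) : KwForm ι P → Prop
  | kw {j : ι} {p : P} : j ≠ owner p → NoTrivial owner (.kw j p)
  | neg {α : KwForm ι P} : NoTrivial owner α → NoTrivial owner (.neg α)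
  | or {α β : KwForm ι P} :
      NoTrivial owner α → NoTrivial owner β → NoTrivial owner (.or α β)

/-- The map `η` on strategy profiles: `Kw_j p ∈ η(ṡ)` iff `p ∈ s_{owner p}(j)`. -/
def etaP {ι P : Type} (owner : P → ι) (s : Profile owner) : Set (QVar owner) :=
  {q | q.1.2 ∈ (s (owner q.1.2)).reveal q.1.1}

/-- The map `η : 𝐒^g → W` on globally uniform strategy profiles. -/
def etaG {ι P : Type} (owner : P → ι) (us : GProfile owner) : Set (QVar owner) :=
  etaP owner (fun i => us.1 i ∅)

/-- Outcome of the associated Boolean game `B_G` (variables `Q`, goals read as Boolean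
formulas over `Q`). -/
noncomputable def ubq {ι P : Type} (owner : P → ι) (γ : ι → KwForm ι P)
    (i : ι) (w : Set (QVar owner)) : ℕ :=
  if kbsat owner w (γ i) then 1 else 0

/-- Deviation by player `i` in `B_G` (player `i` controls `Q_i = {Kw_j p | owner p = i}`). -/
def bDeviateQ {ι P : Type} (owner : P → ι) (w : Set (QVar owner)) (i : ι)
    (wi : Set (QVar owner)) : Set (QVar owner) :=
  {q | if owner q.1.2 = i then q ∈ wi else q ∈ w}

/-- Nash equilibrium of the Boolean game `B_G`. -/
def BNEQ {ι P : Type} (owner : P → ι) (γ : ι → KwForm ι P) (w : Set (QVar owner)) : Prop :=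
  ∀ (i : ι) (wi : Set (QVar owner)), ubq owner γ i w ≥ ubq owner γ i (bDeviateQ owner w i wi)

/-! ## Negation normal form languages as languages of their own -/

/-- The language `L^K_nnf` in negation normal form, as a language of its own. -/
inductive NForm (ι P : Type) : Type where
  | atom : P → NForm ι P
  | natom : P → NForm ι P
  | and : NForm ι P → NForm ι P → NForm ι P
  | or : NForm ι P → NForm ι P → NForm ι P
  | know : ι → NForm ι P → NForm ι P
  | hatK : ι → NForm ι P → NForm ι P

/-- Satisfaction for `NForm`. -/
def nsat {ι P : Type} (owner : P → ι) : Set P → Profile owner → NForm ι P → Prop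
  | v, _, .atom p => p ∈ v
  | v, _, .natom p => p ∉ v
  | v, s, .and α β => nsat owner v s α ∧ nsat owner v s β
  | v, s, .or α β => nsat owner v s α ∨ nsat owner v s β
  | v, s, .know i α => ∀ w, obsRel owner s i v w → nsat owner w s α
  | v, s, .hatK i α => ∃ w, obsRel owner s i v w ∧ nsat owner w s α

/-- The positive fragment `L^+` (no `K̂` modalities). -/
inductive IsPositive {ι P : Type} : NForm ι P → Prop
  | atom (p : P) : IsPositive (.atom p)
  | natom (p : P) : IsPositive (.natom p)
  | and {α β : NForm ι P} : IsPositive α → IsPositive β → IsPositive (.and α β)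
  | or {α β : NForm ι P} : IsPositive α → IsPositive β → IsPositive (.or α β)
  | know {α : NForm ι P} (i : ι) : IsPositive α → IsPositive (.know i α)

/-- The self-positive fragment `L^{j+}`: all occurrences of `K_j` are positive. -/
inductive SelfPos {ι P : Type} (j : ι) : NForm ι P → Prop
  | atom (p : P) : SelfPos j (.atom p)
  | natom (p : P) : SelfPos j (.natom p)
  | and {α β : NForm ι P} : SelfPos j α → SelfPos j β → SelfPos j (.and α β)
  | or {α β : NForm ι P} : SelfPos j α → SelfPos j β → SelfPos j (.or α β)
  | know {α : NForm ι P} (k : ι) : SelfPos j α → SelfPos j (.know k α)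
  | hatK {α : NForm ι P} {k : ι} : k ≠ j → SelfPos j α → SelfPos j (.hatK k α)

/-- `pol owner j φ = (+^j(φ), −^j(φ))`: positive / negative epistemic assertions
about variables of player `j` in the NNF formula `φ`. -/
def pol {ι P : Type} (owner : P → ι) (j : ι) : NForm ι P → Prop × Prop
  | .atom p => (owner p = j, False)
  | .natom p => (owner p = j, False)
  | .and α β => ((pol owner j α).1 ∨ (pol owner j β).1, (pol owner j α).2 ∨ (pol owner j β).2)
  | .or α β => ((pol owner j α).1 ∨ (pol owner j β).1, (pol owner j α).2 ∨ (pol owner j β).2)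
  | .know _ α => pol owner j α
  | .hatK _ α => ((pol owner j α).2, (pol owner j α).1)

/-- `|type(i)|`: the number of elements of `type(i) ⊆ {+, −, c+, c−}`. -/
noncomputable def typeCard {ι P : Type} (owner : P → ι) (γ : ι → NForm ι P) (i : ι) : ℕ :=
  (if ∃ j, j ≠ i ∧ (pol owner j (γ i)).1 then 1 else 0) +
  (if ∃ j, j ≠ i ∧ (pol owner j (γ i)).2 then 1 else 0) +
  (if (pol owner i (γ i)).1 then 1 else 0) +
  (if (pol owner i (γ i)).2 then 1 else 0)

/-- The language `L^Kw_nnf` as a language of its own. -/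
inductive KwNForm (ι P : Type) : Type where
  | kw : ι → P → KwNForm ι P
  | nkw : ι → P → KwNForm ι P
  | and : KwNForm ι P → KwNForm ι P → KwNForm ι P
  | or : KwNForm ι P → KwNForm ι P → KwNForm ι P

/-- Satisfaction for `KwNForm`. -/
def knsat {ι P : Type} (owner : P → ι) : Set P → Profile owner → KwNForm ι P → Prop
  | v, s, .kw j p => kwHolds owner v s j p
  | v, s, .nkw j p => ¬ kwHolds owner v s j p
  | v, s, .and α β => knsat owner v s α ∧ knsat owner v s β
  | v, s, .or α β => knsat owner v s α ∨ knsat owner v s β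

/-- Polarity for `KwNForm`. -/
def kpol {ι P : Type} (owner : P → ι) (j : ι) : KwNForm ι P → Prop × Prop
  | .kw _ p => (owner p = j, False)
  | .nkw _ p => (False, owner p = j)
  | .and α β =>
      ((kpol owner j α).1 ∨ (kpol owner j β).1, (kpol owner j α).2 ∨ (kpol owner j β).2)
  | .or α β =>
      ((kpol owner j α).1 ∨ (kpol owner j β).1, (kpol owner j α).2 ∨ (kpol owner j β).2)

/-- `|type(i)|` for Kw games. -/
noncomputable def ktypeCard {ι P : Type} (owner : P → ι) (γ : ι → KwNForm ι P) (i : ι) : ℕ :=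
  (if ∃ j, j ≠ i ∧ (kpol owner j (γ i)).1 then 1 else 0) +
  (if ∃ j, j ≠ i ∧ (kpol owner j (γ i)).2 then 1 else 0) +
  (if (kpol owner i (γ i)).1 then 1 else 0) +
  (if (kpol owner i (γ i)).2 then 1 else 0)

/-- The strategy profile `s^∀` in which everybody reveals everything to everyone. -/
def allProf {ι P : Type} (owner : P → ι) : Profile owner := fun i =>
  { reveal := fun _ => {p | owner p = i}
    reveal_subset := fun _ _ hp => hp
    reveal_self := rfl }

/-- `Kw_j p` holds at `(v,s)` iff the owner of `p` reveals `p` to `j`. -/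
theorem kwHolds_iff_reveal {ι P : Type} (owner : P → ι) (v : Set P) (s : Profile owner)
    (j : ι) (p : P) : kwHolds owner v s j p ↔ p ∈ (s (owner p)).reveal j := by
  constructor
  · intro h
    by_contra hp
    have hn : p ∉ revealedTo owner s j := by
      rintro ⟨k, hk⟩
      have ho : owner p = k := (s k).reveal_subset j hk
      subst ho
      exact hp hk
    have hadd : obsRel owner s j v (insert p v) := by
      ext q
      simp only [Set.mem_inter_iff, Set.mem_insert_iff]
      constructor
      · rintro ⟨h1, h2⟩
        exact ⟨Or.inr h1, h2⟩
      · rintro ⟨h1 | h1, h2⟩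
        · subst h1
          exact absurd h2 hn
        · exact ⟨h1, h2⟩
    have hdel : obsRel owner s j v (v \ {p}) := by
      ext q
      simp only [Set.mem_inter_iff, Set.mem_diff, Set.mem_singleton_iff]
      constructor
      · rintro ⟨h1, h2⟩
        refine ⟨⟨h1, ?_⟩, h2⟩
        intro h3
        subst h3
        exact hn h2
      · rintro ⟨⟨h1, _⟩, h2⟩
        exact ⟨h1, h2⟩
    rcases h with h | h
    · exact (h _ hdel).2 rfl
    · exact h _ hadd (Set.mem_insert p v)
  · intro hp
    have hr : p ∈ revealedTo owner s j := ⟨owner p, hp⟩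
    have key : ∀ w, obsRel owner s j v w → (p ∈ v ↔ p ∈ w) := by
      intro w hw
      have h1 : p ∈ v ∩ revealedTo owner s j ↔ p ∈ w ∩ revealedTo owner s j := by
        rw [show v ∩ revealedTo owner s j = w ∩ revealedTo owner s j from hw]
      exact ⟨fun h => (h1.1 ⟨h, hr⟩).1, fun h => (h1.2 ⟨h, hr⟩).1⟩
    by_cases hv : p ∈ v
    · exact Or.inl fun w hw => (key w hw).1 hv
    · exact Or.inr fun w hw h => hv ((key w hw).2 h)

/-- Pointwise version: the truth value at any valuation agrees with `η`. -/
theorem ksat_iff_kbsat {ι P : Type} (owner : P → ι) (v : Set P) (s : Profile owner)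
    (α : KwForm ι P) (hα : NoTrivial owner α) :
    ksat owner v s α ↔ kbsat owner (etaP owner s) α := by
  induction hα with
  | kw h =>
    simp only [ksat, kbsat]
    rw [kwHolds_iff_reveal]
    exact ⟨fun hp => ⟨h, hp⟩, fun ⟨_, hp⟩ => hp⟩
  | neg _ ih => simp only [ksat, kbsat, ih]
  | or _ _ ih1 ih2 => simp only [ksat, kbsat, ih1, ih2]

/-- `s ⊨ γ_i` in the epistemic semantics of the Kw game `G` iff
`η(ṡ) ⊨ γ_i` classically, in the associated Boolean game `B_G`. -/
theorem eta_truth {ι P : Type} [Fintype ι] [Fintype P] (owner : P → ι)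
    (γ : ι → KwForm ι P) (hγ : ∀ i, NoTrivial owner (γ i))
    (i : ι) (s : Profile owner) :
    (∀ v : Set P, ksat owner v s (γ i)) ↔ kbsat owner (etaP owner s) (γ i) := by
  exact ⟨fun h => (ksat_iff_kbsat owner ∅ s _ (hγ i)).1 (h ∅),
    fun h v => (ksat_iff_kbsat owner v s _ (hγ i)).2 h⟩
end

section
/- Every two-player Kw game has a pessimist Nash equilibrium: if G = ({1,2},(P_1,P_2),(γ_1,γ_2)) is an observation game with γ_1, γ_2 ∈ L^Kw, then NE_pess(G) ≠ ∅. -/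
open Classical

theorem kwHolds_iff_aux {ι P : Type} (owner : P → ι) (v : Set P) (s : Profile owner)
    (j : ι) (p : P) : kwHolds owner v s j p ↔ p ∈ revealedTo owner s j := by
  constructor
  · intro h
    by_contra hp
    rcases h with h | h
    · refine (h (v \ {p}) ?_).2 rfl
      unfold obsRel
      ext q
      by_cases hq : q = p
      · subst hq; simp [hp]
      · simp [hq]
    · refine h (v ∪ {p}) ?_ (Or.inr rfl)
      unfold obsRel
      ext q
      by_cases hq : q = p
      · subst hq; simp [hp]
      · simp [hq]
  · intro hp
    by_cases hv : p ∈ v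
    · left
      intro w hw
      have : p ∈ v ∩ revealedTo owner s j := ⟨hv, hp⟩
      rw [hw] at this
      exact this.1
    · right
      intro w hw hpw
      have : p ∈ w ∩ revealedTo owner s j := ⟨hpw, hp⟩
      rw [← hw] at this
      exact hv this.1

theorem ksat_indep_aux {ι P : Type} (owner : P → ι) (v w : Set P) (s : Profile owner)
    (α : KwForm ι P) : ksat owner v s α ↔ ksat owner w s α := by
  induction α with
  | kw j p => simp only [ksat, kwHolds_iff_aux]
  | neg α ih => simp only [ksat, ih]
  | or α β ih1 ih2 => simp only [ksat, ih1, ih2]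

theorem strategy_ext_aux {ι P : Type} {owner : P → ι} {i : ι} {s t : Strategy owner i}
    (h : s.reveal = t.reveal) : s = t := by
  cases s; cases t; simp only at h; subst h; rfl

/-- The strategy revealing to the others exactly the own variables that are in `v`. -/
def revStrat {ι P : Type} (owner : P → ι) (i : ι) (v : Set P) : Strategy owner i where
  reveal := fun j => {p | owner p = i ∧ (j = i ∨ p ∈ v)}
  reveal_subset := fun _ _ hp => hp.1
  reveal_self := by ext p; simp

theorem pessVal_eq_one_aux {ι P : Type} (owner : P → ι) (γ : ι → KwForm ι P)
    (i : ι) (v : Set P) (us : UProfile owner) :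
    pessVal owner (fun i v s => ksat owner v s (γ i)) i v us = 1 ↔
      ∀ w, obsInit owner i v w → ksat owner ∅ (applyU owner us w) (γ i) := by
  unfold pessVal outcome
  simp only [ite_eq_left_iff, zero_ne_one, imp_false, not_not]
  exact forall_congr' fun w => imp_congr_right fun _ => ksat_indep_aux owner _ _ _ _

theorem pessGt_aux {ι P : Type} (owner : P → ι) (win : ι → Set P → Profile owner → Prop)
    (i : ι) (v : Set P) (us us' : UProfile owner)
    (h : pessVal owner win i v us = 1 → pessVal owner win i v us' = 1) :
    ¬ (pessVal owner win i v us > pessVal owner win i v us') := by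
  intro hgt
  have h1 : pessVal owner win i v us ≤ 1 := by unfold pessVal; split <;> simp
  have h2 : pessVal owner win i v us = 1 := by omega
  have := h h2
  omega

/-- every two-player Kw game has a pessimist Nash equilibrium. -/
theorem two_player_kw_NEpess {P : Type} [Fintype P] (owner : P → Fin 2)
    (γ : Fin 2 → KwForm (Fin 2) P) :
    ∃ us : UProfile owner, NEpess owner (fun i v s => ksat owner v s (γ i)) us := by
  by_cases hdom : ∃ (i : Fin 2) (t : Strategy owner i), ∀ s : Profile owner,
      ksat owner ∅ (Function.update s i t) (γ i)
  · obtain ⟨i, t, ht⟩ := hdom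
    have hs : ∃ s : Profile owner, s i = t ∧ ∀ k, k ≠ i → ∀ t' : Strategy owner k,
        ksat owner ∅ (Function.update s k t') (γ k) → ksat owner ∅ s (γ k) := by
      have hk : ∀ k : Fin 2, k ≠ i → k = i + 1 := by
        clear * -
        intro k h
        omega
      by_cases hw : ∃ s : Profile owner, s i = t ∧ ksat owner ∅ s (γ (i + 1))
      · obtain ⟨s, h1, h2⟩ := hw
        refine ⟨s, h1, fun k hki _ _ => ?_⟩
        rw [hk k hki]; exact h2
      · refine ⟨Function.update (allProf owner) i t, by simp, fun k hki t' h => ?_⟩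
        have hk' := hk k hki
        subst hk'
        refine (hw ⟨_, ?_, h⟩).elim
        rw [Function.update_of_ne (Ne.symm hki)]; simp
    obtain ⟨s, hsi, hs⟩ := hs
    refine ⟨fun k _ => s k, fun _ _ _ _ => rfl, fun k f hf v => pessGt_aux _ _ _ _ _ _ ?_⟩
    rw [pessVal_eq_one_aux, pessVal_eq_one_aux]
    intro h w hw
    have e : applyU owner (fun k _ => s k) w = s := rfl
    rw [e]
    by_cases hki : k = i
    · subst hki
      have := ht s
      rw [← hsi, Function.update_eq_self] at this
      exact this
    · refine hs k hki (f w) ?_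
      convert h w hw using 1
      funext j
      by_cases hj : j = k
      · subst hj; simp [applyU]
      · simp [applyU, hj]
  · refine ⟨fun i v => revStrat owner i v, ?_, fun k f hf v => pessGt_aux _ _ _ _ _ _ ?_⟩
    · intro i v w h
      apply strategy_ext_aux
      funext j
      ext p
      have := Set.ext_iff.1 h p
      simp only [Set.mem_inter_iff, Set.mem_setOf_eq] at this
      simp only [revStrat, Set.mem_setOf_eq]
      tauto
    · rw [pessVal_eq_one_aux]
      intro h
      refine (hdom ⟨k, f v, fun s => ?_⟩).elim
      let w : Set P := {p | if owner p = k then p ∈ v else p ∈ (s (owner p)).reveal k}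
      have hvw : obsInit owner k v w := by
        unfold obsInit
        ext p
        simp only [Set.mem_inter_iff, Set.mem_setOf_eq, w]
        by_cases hp : owner p = k <;> simp [hp]
      convert h w hvw using 1
      funext j
      by_cases hj : j = k
      · subst hj; simp [applyU, hf v w hvw]
      · simp only [applyU, ne_eq, hj, not_false_eq_true, Function.update_of_ne]
        apply strategy_ext_aux
        funext l
        by_cases hl : l = j
        · subst hl
          rw [Strategy.reveal_self, Strategy.reveal_self]
        · have hlk : l = k := by
            clear * - hl hj
            omega
          subst hlk
          ext p
          simp only [revStrat, Set.mem_setOf_eq, w, hl, false_or]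
          constructor
          · intro hp
            have := (s j).reveal_subset _ hp
            simp only [Set.mem_setOf_eq] at this
            subst this
            simp [hj, hp]
          · rintro ⟨rfl, hp⟩
            simpa [hj] using hp
end

section
/- Let G = (N,(P_i),(γ_i)) be an observation game in which every goal γ_i is in the positive fragment L^+. Then G has a Nash equilibrium for each of the pessimist, optimist, and maximal outcome relations; indeed the globally uniform profile ṡ^∀ in which every player reveals all its variables to everyone is a Nash equilibrium for each of these outcome relations. -/
open Classical

/-- Under `s^∀` observation is equality, so positive formulas true under any profile
remain true under `s^∀`. -/
theorem nsat_allProf_of_nsat {ι P : Type} (owner : P → ι) (s : Profile owner)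
    {α : NForm ι P} (hα : IsPositive α) :
    ∀ v, nsat owner v s α → nsat owner v (allProf owner) α := by
  induction hα with
  | atom p => exact fun v h => h
  | natom p => exact fun v h => h
  | and _ _ iha ihb => exact fun v h => ⟨iha v h.1, ihb v h.2⟩
  | or _ _ iha ihb => exact fun v h => h.imp (iha v) (ihb v)
  | know i _ ih =>
    intro v h w hw
    have huniv : revealedTo owner (allProf owner) i = Set.univ :=
      Set.eq_univ_of_forall fun p => ⟨owner p, rfl⟩
    have hvw : v = w := by
      unfold obsRel at hw
      rwa [huniv, Set.inter_univ, Set.inter_univ] at hw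
    subst hvw
    exact ih v (h v rfl)

theorem outcome_le_allProf {ι P : Type} (owner : P → ι) (γ : ι → NForm ι P)
    (hγ : ∀ i, IsPositive (γ i)) (i : ι) (v : Set P) (s : Profile owner) :
    outcome owner (fun i v s => nsat owner v s (γ i)) i v s ≤
      outcome owner (fun i v s => nsat owner v s (γ i)) i v (allProf owner) := by
  unfold outcome
  by_cases h : nsat owner v s (γ i)
  · rw [if_pos h, if_pos (nsat_allProf_of_nsat owner s (hγ i) v h)]
  · rw [if_neg h]; exact Nat.zero_le _

theorem outcome_le_one {ι P : Type} (owner : P → ι)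
    (win : ι → Set P → Profile owner → Prop) (i : ι) (v : Set P) (s : Profile owner) :
    outcome owner win i v s ≤ 1 := by
  unfold outcome
  split_ifs <;> omega

/-- with positive goals, the globally uniform profile `ṡ^∀` (everybody
reveals everything to everyone) is a pessimist, optimist, and maximal Nash equilibrium. -/
theorem positive_allProf_NE {ι P : Type} [Fintype ι] [Fintype P] [DecidableEq ι]
    (owner : P → ι) (γ : ι → NForm ι P) (hγ : ∀ i, IsPositive (γ i)) :
    NEpess owner (fun i v s => nsat owner v s (γ i)) (fun i _ => allProf owner i) ∧
    NEopt owner (fun i v s => nsat owner v s (γ i)) (fun i _ => allProf owner i) ∧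
    NEmax owner (fun i v s => nsat owner v s (γ i)) (fun i _ => allProf owner i) := by
  have key := outcome_le_allProf owner γ hγ
  have one := outcome_le_one owner (fun i v s => nsat owner v s (γ i))
  refine ⟨⟨fun i v w _ => rfl, ?_⟩, ⟨fun i v w _ => rfl, ?_⟩, ⟨fun i v w _ => rfl, ?_⟩⟩
  · intro i f _ v
    rw [gt_iff_lt, not_lt]
    unfold pessVal
    split_ifs with h1 h2
    · exact le_rfl
    · refine absurd (fun w hw => le_antisymm (one i w _) ?_) h2
      exact (h1 w hw).symm.le.trans (key i w _)
    · exact Nat.zero_le _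
    · exact le_rfl
  · intro i f _ v
    rw [gt_iff_lt, not_lt]
    unfold optVal
    split_ifs with h1 h2
    · exact le_rfl
    · obtain ⟨w, hw, h⟩ := h1
      refine absurd ⟨w, hw, le_antisymm (one i w _) ?_⟩ h2
      exact h.symm.le.trans (key i w _)
    · exact Nat.zero_le _
    · exact le_rfl
  · rintro i f _ v ⟨w, _, h⟩
    exact absurd (key i w _) (not_le.mpr h)
end
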